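/- arXiv:2511.02641 — 2 statements merged into one kernel-verified Lean document; each statement's English description precedes it below -/
import Mathlib

section
/- Let k be a field, S := k[X_1,…,X_{d+2}] the polynomial ring graded by G with deg X_i := x_i (so S = ⊕_{g ∈ G} S_g, where S_g is spanned by the monomials ΠX_i^{a_i} with Σa_i x_i = g), and 𝔞 := (X_1,…,X_l)·(X_{l+1},…,X_{d+2}) ⊆ S. Let J ∈ 𝒥_H, and let M = ⊕_{g ∈ G} M_g be a finitely generated G-graded S-module (S_g·M_h ⊆ M_{g+h}). If the set {g ∈ q^{−1}(J) : M_g ≠ 0} is finite, then for every homogeneous element u ∈ M there exists n ≥ 0 with 𝔞^n u = 0; consequently M is supported on V(𝔞). -/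
open scoped Classical

noncomputable section

namespace Paper

/-- The ambient lattice `ℤ^(d+1)`. -/
abbrev V (d : ℕ) : Type := Fin (d + 1) → ℤ

/-- The coordinate-sum homomorphism. -/
def sumHom (d : ℕ) : V d →+ ℤ :=
  AddMonoidHom.mk' (fun v => ∑ i, v i) (fun a b => by
    simp [Finset.sum_add_distrib])

/-- The lattice `L` of integer vectors with coordinate sum zero. -/
def L (d : ℕ) : AddSubgroup (V d) := (sumHom d).ker

/-- `α i = e_i - e_{i-1}` (indices cyclic mod `d+1`), as an element of `L`. -/
def alpha (d : ℕ) (i : Fin (d + 1)) : L d :=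
  ⟨Pi.single i 1 - Pi.single (i - 1) 1, by
    have : sumHom d (Pi.single i 1 - Pi.single (i - 1) 1) = 0 := by
      simp [sumHom, Finset.sum_sub_distrib, Pi.single_apply]
    exact this⟩

/-- Arrows of the infinite quiver `Q̂`: the pair (source, type); the arrow of type `i`
with source `x` goes from `x` to `x + α i`. -/
abbrev ArrowHat (d : ℕ) : Type := L d × Fin (d + 1)

/-- Arrows of the quiver `Q` on `L/B`: the pair (source, type). -/
abbrev Arrow (d : ℕ) (B : AddSubgroup (L d)) : Type := (L d ⧸ B) × Fin (d + 1)

/-- The preimage among arrows of `Q̂` of a set of arrows of `Q`. -/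
def preim (d : ℕ) (B : AddSubgroup (L d)) (C : Set (Arrow d B)) : Set (ArrowHat d) :=
  {a | ((QuotientAddGroup.mk a.1 : L d ⧸ B), a.2) ∈ C}

/-- A set of arrows of `Q̂` is a cut if it contains exactly one arrow of every elementary
cycle.  Elementary cycles are exactly the cyclic paths of length `d+1` with pairwise distinct
types; they are parametrized by a starting vertex `x` and a permutation `σ` of the types,
the `k`-th arrow being the type-`σ k` arrow with source `x + ∑_{j<k} α (σ j)`. -/
def IsCutHat (d : ℕ) (Ch : Set (ArrowHat d)) : Prop :=
  ∀ (x : L d) (σ : Equiv.Perm (Fin (d + 1))),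
    ∃! k : Fin (d + 1), (x + ∑ j ∈ Finset.Iio k, alpha d (σ j), σ k) ∈ Ch

/-- A set of arrows of `Q̂` is `B`-periodic if it is invariant under translation by `B`. -/
def IsBPeriodic (d : ℕ) (B : AddSubgroup (L d)) (Ch : Set (ArrowHat d)) : Prop :=
  ∀ (a : ArrowHat d) (b : L d), b ∈ B → ((a.1 + b, a.2) ∈ Ch ↔ a ∈ Ch)

/-- A set of arrows of `Q` is a cut if its preimage among the arrows of `Q̂` is a cut. -/
def IsCut (d : ℕ) (B : AddSubgroup (L d)) (C : Set (Arrow d B)) : Prop :=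
  IsCutHat d (preim d B C)

/-- The type of a cut of `Q`: the `i`-th entry is the number of arrows of type `i` in it. -/
def cutType (d : ℕ) (B : AddSubgroup (L d)) (C : Set (Arrow d B)) : Fin (d + 1) → ℤ :=
  fun i => (Nat.card {v : L d ⧸ B // (v, i) ∈ C} : ℤ)

/-- A cut detector of type `γ`. -/
def IsCutDetector (d : ℕ) (B : AddSubgroup (L d)) (f : L d ⧸ B → ℤ)
    (γ : Fin (d + 1) → ℤ) : Prop :=
  f 0 = 0 ∧ ∀ (x : L d) (i : Fin (d + 1)),
    f (QuotientAddGroup.mk (x + alpha d i)) = f (QuotientAddGroup.mk x) + γ i ∨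
    f (QuotientAddGroup.mk (x + alpha d i)) = f (QuotientAddGroup.mk x) + γ i - (B.index : ℤ)

/-- The value `f_C` of an arrow of `Q̂`: `γ i - m` if the arrow lies in the given set of
arrows, and `γ i` otherwise (for an arrow of type `i`). -/
def arrowVal (d : ℕ) (Ch : Set (ArrowHat d)) (γ : Fin (d + 1) → ℤ) (m : ℤ)
    (a : ArrowHat d) : ℤ :=
  if a ∈ Ch then γ a.2 - m else γ a.2

/-- The value `f_C` of a path in `Q̂`, the path being recorded as its list of types together
with its source: the sum of the values of its arrows. -/
def pathVal (d : ℕ) (Ch : Set (ArrowHat d)) (γ : Fin (d + 1) → ℤ) (m : ℤ) :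
    List (Fin (d + 1)) → L d → ℤ
  | [], _ => 0
  | i :: p, x => arrowVal d Ch γ m (x, i) + pathVal d Ch γ m p (x + alpha d i)

/-- `f` is the function `f̄_C` induced by `f_C` on `L/B`:  for every `x ∈ L` and every path
`p` in `Q̂` from `0` to `x`, `f(x + B)` is the value of `p`. -/
def Detects (d : ℕ) (B : AddSubgroup (L d)) (C : Set (Arrow d B)) (γ : Fin (d + 1) → ℤ)
    (f : L d ⧸ B → ℤ) : Prop :=
  ∀ (x : L d) (p : List (Fin (d + 1))), (p.map (alpha d)).sum = x →
    f (QuotientAddGroup.mk x) = pathVal d (preim d B C) γ (B.index : ℤ) p 0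

/-- The set of arrows `C_f` of `Q` associated to a function `f : L/B → ℤ` (of type `γ`):
the arrows `x + B → x + α i + B` with `f(x + α i + B) = f(x + B) + γ i - m`. -/
def cutOf (d : ℕ) (B : AddSubgroup (L d)) (f : L d ⧸ B → ℤ) (γ : Fin (d + 1) → ℤ) :
    Set (Arrow d B) :=
  {a | ∃ x : L d, QuotientAddGroup.mk x = a.1 ∧
      f (QuotientAddGroup.mk (x + alpha d a.2)) = f a.1 + γ a.2 - (B.index : ℤ)}


/-- A path in the quiver `Q_C = Q ∖ C`, recorded as its list of types plus its source:
all its arrows avoid `C`. -/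
def avoids (d : ℕ) (B : AddSubgroup (L d)) (C : Set (Arrow d B)) :
    List (Fin (d + 1)) → (L d ⧸ B) → Prop
  | [], _ => True
  | i :: p, v => (v, i) ∉ C ∧ avoids d B C p (v + QuotientAddGroup.mk (alpha d i))

/-- A cut `C` of `Q` is bounding if the quiver `Q_C` obtained by deleting the arrows of `C`
has no cyclic path of positive length. -/
def IsBounding (d : ℕ) (B : AddSubgroup (L d)) (C : Set (Arrow d B)) : Prop :=
  ¬ ∃ (v : L d ⧸ B) (p : List (Fin (d + 1))), p ≠ [] ∧ avoids d B C p v ∧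
      v + QuotientAddGroup.mk ((p.map (alpha d)).sum) = v

/-- The homomorphism `Φ : ℤ^(d+1) → ℤ ⊕ L/B` with `Φ(e_i) = (γ_i, α_i + B)`. -/
def Phi (d : ℕ) (B : AddSubgroup (L d)) (γ : Fin (d + 1) → ℤ) :
    V d →+ ℤ × (L d ⧸ B) :=
  AddMonoidHom.mk'
    (fun v => (∑ i, v i * γ i, QuotientAddGroup.mk (∑ i, v i • alpha d i)))
    (fun a b => by
      have h1 : ∑ i, (a + b) i * γ i = (∑ i, a i * γ i) + ∑ i, b i * γ i := by
        rw [← Finset.sum_add_distrib]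
        exact Finset.sum_congr rfl fun i _ => by simp [add_mul]
      have h2 : (∑ i, (a + b) i • alpha d i) =
          (∑ i, a i • alpha d i) + ∑ i, b i • alpha d i := by
        rw [← Finset.sum_add_distrib]
        exact Finset.sum_congr rfl fun i _ => by simp [add_smul]
      show (∑ i, (a + b) i * γ i, QuotientAddGroup.mk (∑ i, (a + b) i • alpha d i)) =
        ((∑ i, a i * γ i, QuotientAddGroup.mk (∑ i, a i • alpha d i)) : ℤ × (L d ⧸ B)) +
          (∑ i, b i * γ i, QuotientAddGroup.mk (∑ i, b i • alpha d i))
      rw [Prod.mk_add_mk, h1, h2, QuotientAddGroup.mk_add])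

/-- The group `G(B,γ)`, the image of `Φ`. -/
abbrev GB (d : ℕ) (B : AddSubgroup (L d)) (γ : Fin (d + 1) → ℤ) :
    AddSubgroup (ℤ × (L d ⧸ B)) :=
  (Phi d B γ).range

/-- The element `x_i = Φ(e_i)` of `G(B,γ)`. -/
def xE (d : ℕ) (B : AddSubgroup (L d)) (γ : Fin (d + 1) → ℤ) (i : Fin (d + 1)) :
    GB d B γ :=
  ⟨Phi d B γ (Pi.single i 1), ⟨Pi.single i 1, rfl⟩⟩

/-- The element `p = ∑ x_i` of `G(B,γ)`. -/
def pE (d : ℕ) (B : AddSubgroup (L d)) (γ : Fin (d + 1) → ℤ) : GB d B γ :=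
  ∑ i, xE d B γ i

/-- Membership in `𝒥`: `J` contains exactly one element of every coset of `ℤp`, and for
`g ∈ J` and every `i`, `g + x_i ∈ J ∪ (J + p)`. -/
def InJ (d : ℕ) (B : AddSubgroup (L d)) (γ : Fin (d + 1) → ℤ)
    (J : Set (GB d B γ)) : Prop :=
  (∀ g : GB d B γ, ∃! n : ℤ, g + n • pE d B γ ∈ J) ∧
    ∀ g ∈ J, ∀ i : Fin (d + 1), g + xE d B γ i ∈ J ∨ g + xE d B γ i - pE d B γ ∈ J

/-- `f` is the function `f_J : L/B → ℤ` attached to `J ∈ 𝒥`:  whenever `n_J • p ∈ J`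
and `g ∈ J`, the value of `f` at the image of `g` under the second projection is
`π₁(g) - n_J · m`. -/
def IsFJ (d : ℕ) (B : AddSubgroup (L d)) (γ : Fin (d + 1) → ℤ)
    (J : Set (GB d B γ)) (f : L d ⧸ B → ℤ) : Prop :=
  ∀ n : ℤ, n • pE d B γ ∈ J → ∀ g ∈ J,
    f (g : ℤ × (L d ⧸ B)).2 = (g : ℤ × (L d ⧸ B)).1 - n * (B.index : ℤ)

/-- The cone of nonnegative integer combinations of the `x i`. -/
def cone {G : Type*} [AddCommGroup G] {n : ℕ} (x : Fin n → G) : Set G :=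
  {g | ∃ c : Fin n → ℕ, g = ∑ i, (c i : ℤ) • x i}

/-- Upper sets for the partial order `g ≤ h ↔ h - g ∈ cone x`. -/
def IsUpper {G : Type*} [AddCommGroup G] {n : ℕ} (x : Fin n → G) (I : Set G) : Prop :=
  ∀ g ∈ I, ∀ h : G, h - g ∈ cone x → h ∈ I

/-- `J(I) = I ∩ (Iᶜ + p)`. -/
def JofI {G : Type*} [AddCommGroup G] (p : G) (I : Set G) : Set G :=
  {g | g ∈ I ∧ g - p ∉ I}

/-- The set `𝒥̃` of subsets `J` with `g ≱ h + p` for all `g, h ∈ J` (where `p = ∑ x i`). -/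
def tilJSet {G : Type*} [AddCommGroup G] {n : ℕ} (x : Fin n → G) : Set (Set G) :=
  {J | ∀ g ∈ J, ∀ h ∈ J, g - (h + ∑ i, x i) ∉ cone x}

/-- The homomorphism `ℤ^(d+1) → G` sending `e_i` to `x i`. -/
def PhiG {G : Type*} [AddCommGroup G] (d : ℕ) (x : Fin (d + 1) → G) : V d →+ G :=
  AddMonoidHom.mk' (fun v => ∑ i, v i • x i) (fun a b => by
    rw [← Finset.sum_add_distrib]
    exact Finset.sum_congr rfl fun i _ => by simp [add_smul])

/-- A finitely generated abelian group of rank one with elements `x_0, …, x_d`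
satisfying (G1), (G2), (G3).  (Rank one is expressed by the existence of a surjective
homomorphism to `ℤ` whose kernel is exactly the torsion.) -/
def GoodPair (d : ℕ) (G : Type*) [AddCommGroup G] (x : Fin (d + 1) → G) : Prop :=
  AddGroup.FG G ∧
  (∃ π' : G →+ ℤ, Function.Surjective π' ∧ ∀ g : G, π' g = 0 ↔ IsOfFinAddOrder g) ∧
  (∀ i, x i ≠ 0) ∧
  (∀ g : G, ∃ c : Fin (d + 1) → ℤ, g = ∑ i, c i • x i) ∧
  (∀ g : G, g ∈ cone x → -g ∈ cone x → g = 0)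

/-- A pair `(B, γ)` of a finite-index subgroup `B ⊆ L` and a positive integer vector `γ`
satisfying the two conditions of Theorem `chartype`. -/
def GoodBgamma (d : ℕ) (B : AddSubgroup (L d)) (γ : Fin (d + 1) → ℤ) : Prop :=
  B.FiniteIndex ∧ (∀ i, 0 < γ i) ∧ (∑ i, γ i) = (B.index : ℤ) ∧
    ∀ m' : Fin (d + 1) → ℤ, (∑ i, m' i • alpha d i) ∈ B →
      (B.index : ℤ) ∣ ∑ i, m' i * γ i

/-- The images `q(x_1),…,q(x_l),q(-x_{l+1}),…,q(-x_{d+2})` in `H = G/ℤp`. -/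
def yq {G : Type*} [AddCommGroup G] (d l : ℕ) (x : Fin (d + 2) → G) (i : Fin (d + 2)) :
    G ⧸ AddSubgroup.zmultiples (∑ j, x j) :=
  if (i : ℕ) < l then QuotientAddGroup.mk (x i) else QuotientAddGroup.mk (-x i)

/-- The element `s = ∑_{i ≤ l} q(x_i)` of `H`. -/
def sElt {G : Type*} [AddCommGroup G] (d l : ℕ) (x : Fin (d + 2) → G) :
    G ⧸ AddSubgroup.zmultiples (∑ j, x j) :=
  ∑ i ∈ Finset.univ.filter (fun i : Fin (d + 2) => (i : ℕ) < l),
    (QuotientAddGroup.mk (x i) : G ⧸ AddSubgroup.zmultiples (∑ j, x j))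

/-- The set `𝒥̃_H` of subsets `J ⊆ H` such that `h ≱ h' + s` for all `h, h' ∈ J`. -/
def tilJH {G : Type*} [AddCommGroup G] (d l : ℕ) (x : Fin (d + 2) → G) :
    Set (Set (G ⧸ AddSubgroup.zmultiples (∑ j, x j))) :=
  {J | ∀ h ∈ J, ∀ h' ∈ J, h - (h' + sElt d l x) ∉ cone (yq d l x)}

theorem cone_add' {G : Type*} [AddCommGroup G] {n : ℕ} (x : Fin n → G) {a b : G}
    (ha : a ∈ cone x) (hb : b ∈ cone x) : a + b ∈ cone x := by
  obtain ⟨c, rfl⟩ := ha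
  obtain ⟨e, rfl⟩ := hb
  refine ⟨c + e, ?_⟩
  rw [← Finset.sum_add_distrib]
  exact Finset.sum_congr rfl fun i _ => by simp [add_smul]

theorem cone_zero' {G : Type*} [AddCommGroup G] {n : ℕ} (x : Fin n → G) :
    (0 : G) ∈ cone x := ⟨0, by simp⟩

theorem cone_gen' {G : Type*} [AddCommGroup G] {n : ℕ} (x : Fin n → G) (i : Fin n) (a : ℕ) :
    a • x i ∈ cone x := by
  refine ⟨Pi.single i a, ?_⟩
  rw [Finset.sum_eq_single i]
  · simp
  · intro j _ hj; simp [hj]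
  · simp

theorem cone_large {H : Type*} [AddCommGroup H] {n : ℕ} (y : Fin n → H)
    (hAB : ∀ i j, ∃ A B : ℕ, 0 < B ∧ A • y i = B • y j)
    (hgen : ∀ z : H, ∃ c : Fin n → ℤ, z = ∑ i, c i • y i) (i : Fin n) (z : H) :
    ∃ N : ℕ, z + N • y i ∈ cone y := by
  obtain ⟨c, rfl⟩ := hgen z
  choose A B hB hAB using hAB i
  refine ⟨∑ j, (c j).natAbs * A j, fun j => (c j + (c j).natAbs * B j).toNat, ?_⟩
  rw [Finset.sum_smul, ← Finset.sum_add_distrib]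
  refine Finset.sum_congr rfl fun j _ => ?_
  have h1 : (0 : ℤ) ≤ c j + (c j).natAbs * B j := by
    have : (1 : ℤ) ≤ B j := by exact_mod_cast hB j
    have h2 : -c j ≤ ((c j).natAbs : ℤ) := by omega
    nlinarith [Int.natCast_nonneg (c j).natAbs]
  rw [Int.toNat_of_nonneg h1, mul_smul, hAB j, add_smul, mul_smul]
  simp only [natCast_zsmul]

theorem comb {H : Type*} [AddCommGroup H] {n : ℕ} (y : Fin n → H)
    (hAB : ∀ i j, ∃ A B : ℕ, 0 < B ∧ A • y i = B • y j)
    (hgen : ∀ z : H, ∃ c : Fin n → ℤ, z = ∑ i, c i • y i)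
    (s : H) (hs : -s ∉ cone y) (J : Set H)
    (hJ : ∀ h ∈ J, ∀ h' ∈ J, h - (h' + s) ∉ cone y)
    (hmax : ∀ J' : Set H, (∀ h ∈ J', ∀ h' ∈ J', h - (h' + s) ∉ cone y) → J ⊆ J' → J' = J)
    (i j : Fin n) (hsi : s - y i ∈ cone y) (h : H) :
    ∃ B : ℕ, ∀ b ≥ B, ∃ a : ℕ, h + a • y i - b • y j ∈ J := by
  -- key membership criterion
  have key : ∀ z : H, (∃ h' ∈ J, z - h' ∈ cone y) → (¬ ∃ h' ∈ J, z - s - h' ∈ cone y) →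
      z ∈ J := by
    rintro z ⟨w, hw, hzw⟩ hz2
    have : insert z J = J := by
      refine hmax _ ?_ (Set.subset_insert _ _)
      rintro a (rfl | ha) b (rfl | hb) hab
      · exact hs (by convert hab using 1; abel)
      · exact hz2 ⟨b, hb, by convert hab using 1; abel⟩
      · exact hJ a ha w hw (by convert cone_add' y hab hzw using 1; abel)
      · exact hJ a ha b hb hab
    rw [← this]; exact Set.mem_insert _ _
  have hne : J.Nonempty := by
    by_contra hemp
    rw [Set.not_nonempty_iff_eq_empty] at hemp
    have h1 := hmax {0} (by
      rintro a rfl b rfl hab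
      exact hs (by convert hab using 1; abel)) (by simp [hemp])
    rw [hemp] at h1
    exact Set.singleton_ne_empty _ h1
  obtain ⟨w, hw⟩ := hne
  obtain ⟨N, hN⟩ := cone_large y hAB hgen j (w - s - h)
  refine ⟨N, fun b hb => ?_⟩
  have hlow : ¬ ∃ h' ∈ J, h - b • y j - h' ∈ cone y := by
    rintro ⟨h', hh', hc⟩
    refine hJ w hw h' hh' ?_
    have h3 := cone_add' y (cone_add' y hN (cone_gen' y j (b - N))) hc
    obtain ⟨e, rfl⟩ := Nat.exists_eq_add_of_le hb
    rw [Nat.add_sub_cancel_left, add_smul] at h3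
    convert h3 using 1; abel
  have hex : ∃ a : ℕ, ∃ h' ∈ J, h + a • y i - b • y j - h' ∈ cone y := by
    obtain ⟨a, ha⟩ := cone_large y hAB hgen i (h - b • y j - w)
    exact ⟨a, w, hw, by convert ha using 1; abel⟩
  obtain ⟨a, ha, hmin⟩ : ∃ a : ℕ, (∃ h' ∈ J, h + a • y i - b • y j - h' ∈ cone y) ∧
      ∀ a' < a, ¬ ∃ h' ∈ J, h + a' • y i - b • y j - h' ∈ cone y :=
    ⟨Nat.find hex, Nat.find_spec hex, fun a' h' => Nat.find_min hex h'⟩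
  refine ⟨a, key _ ha ?_⟩
  rintro ⟨h', hh', hc⟩
  rcases a with _ | a
  · exact hlow (by simpa using ha)
  · refine hmin a (Nat.lt_succ_self a) ⟨h', hh', ?_⟩
    convert cone_add' y hc hsi using 1
    rw [succ_nsmul]; abel

theorem graded_module_supported_on_V_frak_a (d : ℕ) (hd : 1 ≤ d)
    (G : Type*) [AddCommGroup G] (hfg : AddGroup.FG G)
    (ρ : G →+ ℤ × ℤ) (hρsurj : Function.Surjective ρ)
    (hρker : ∀ g : G, ρ g = 0 ↔ IsOfFinAddOrder g)
    (x : Fin (d + 2) → G) (hG1 : ∀ i, x i ≠ 0)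
    (hG2 : ∀ g : G, ∃ c : Fin (d + 2) → ℤ, g = ∑ i, c i • x i)
    (hG3 : ∀ g : G, g ∈ cone x → -g ∈ cone x → g = 0)
    (hp : ¬ IsOfFinAddOrder (∑ i, x i))
    (π : G →+ ℤ) (hπsurj : Function.Surjective π)
    (hπker : ∀ g : G, π g = 0 ↔
      IsOfFinAddOrder (QuotientAddGroup.mk g : G ⧸ AddSubgroup.zmultiples (∑ i, x i)))
    (l : ℕ) (hl1 : 1 ≤ l) (hl2 : l ≤ d + 1)
    (hsplit : ∀ i : Fin (d + 2),
      ((i : ℕ) < l → 0 < π (x i)) ∧ (l ≤ (i : ℕ) → π (x i) < 0))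
    (k : Type*) [Field k]
    (J : Set (G ⧸ AddSubgroup.zmultiples (∑ i, x i)))
    (hJ : J ∈ tilJH d l x ∧ ∀ J' ∈ tilJH d l x, J ⊆ J' → J' = J)
    (M : Type*) [AddCommGroup M] [Module (MvPolynomial (Fin (d + 2)) k) M]
    [Module k M] [IsScalarTower k (MvPolynomial (Fin (d + 2)) k) M]
    (ℳ : G → Submodule k M) [DirectSum.Decomposition ℳ]
    (hcompat : ∀ (g h : G) (s : MvPolynomial (Fin (d + 2)) k) (u : M),
      s ∈ MvPolynomial.weightedHomogeneousSubmodule k x g → u ∈ ℳ h → s • u ∈ ℳ (g + h))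
    (hMfin : Module.Finite (MvPolynomial (Fin (d + 2)) k) M)
    (hfin : {g : G |
      (QuotientAddGroup.mk g : G ⧸ AddSubgroup.zmultiples (∑ i, x i)) ∈ J ∧
        ℳ g ≠ ⊥}.Finite)
    (𝔞 : Ideal (MvPolynomial (Fin (d + 2)) k))
    (h𝔞 : 𝔞 = Ideal.span {s | ∃ i : Fin (d + 2), (i : ℕ) < l ∧ s = MvPolynomial.X i} *
        Ideal.span {s | ∃ i : Fin (d + 2), l ≤ (i : ℕ) ∧ s = MvPolynomial.X i}) :
    (∀ (g : G) (u : M), u ∈ ℳ g → ∃ n : ℕ, ∀ s ∈ 𝔞 ^ n, s • u = 0) ∧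
    (∀ u : M, ∃ n : ℕ, ∀ s ∈ 𝔞 ^ n, s • u = 0) := by
  have hmain : ∀ (g : G) (u : M), u ∈ ℳ g → ∃ n : ℕ, ∀ s ∈ 𝔞 ^ n, s • u = 0 := by
    intro g u hu
    have hπp : π (∑ i, x i) = 0 := by
      rw [hπker, (QuotientAddGroup.eq_zero_iff _).2 (AddSubgroup.mem_zmultiples _)]
      exact IsOfFinAddOrder.zero
    let π' : G ⧸ AddSubgroup.zmultiples (∑ i, x i) →+ ℤ :=
      QuotientAddGroup.lift _ π (by
        intro z hz
        obtain ⟨m, rfl⟩ := AddSubgroup.mem_zmultiples_iff.1 hz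
        rw [AddMonoidHom.mem_ker, map_zsmul, hπp, smul_zero])
    have hπ' : ∀ z : G, π' (QuotientAddGroup.mk z) = π z := fun z => rfl
    have htor : ∀ z, π' z = 0 → ∃ m : ℕ, 0 < m ∧ m • z = 0 := by
      intro z hz
      obtain ⟨z, rfl⟩ := QuotientAddGroup.mk_surjective z
      exact isOfFinAddOrder_iff_nsmul_eq_zero.1 ((hπker z).1 hz)
    have hypos : ∀ i, 0 < π' (yq d l x i) := by
      intro i
      unfold yq
      split_ifs with h
      · exact (hsplit i).1 h
      · rw [hπ', map_neg]
        have := (hsplit i).2 (not_lt.1 h)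
        omega
    have hAB : ∀ i j, ∃ A B : ℕ, 0 < B ∧ A • yq d l x i = B • yq d l x j := by
      intro i j
      obtain ⟨α, hα⟩ := Int.eq_ofNat_of_zero_le (hypos i).le
      obtain ⟨β, hβ⟩ := Int.eq_ofNat_of_zero_le (hypos j).le
      have hα0 : 0 < α := by have := hypos i; omega
      obtain ⟨m, hm, h0⟩ := htor (β • yq d l x i - α • yq d l x j) (by
        rw [map_sub, map_nsmul, map_nsmul, hα, hβ]
        simp [mul_comm])
      refine ⟨m * β, m * α, Nat.mul_pos hm hα0, ?_⟩
      rw [smul_sub, sub_eq_zero] at h0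
      rw [mul_smul, mul_smul, h0]
    have hgen : ∀ z : G ⧸ AddSubgroup.zmultiples (∑ i, x i),
        ∃ c : Fin (d + 2) → ℤ, z = ∑ i, c i • yq d l x i := by
      intro z
      obtain ⟨z, rfl⟩ := QuotientAddGroup.mk_surjective z
      obtain ⟨c, rfl⟩ := hG2 z
      refine ⟨fun i => if (i : ℕ) < l then c i else - c i, ?_⟩
      rw [← QuotientAddGroup.mk'_apply, map_sum]
      refine Finset.sum_congr rfl fun i _ => ?_
      rw [map_zsmul, QuotientAddGroup.mk'_apply]
      by_cases h : (i : ℕ) < l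
      · simp [yq, h]
      · simp [yq, h]
    have hsy : sElt d l x = ∑ i ∈ Finset.univ.filter (fun i : Fin (d + 2) => (i : ℕ) < l),
        yq d l x i := by
      refine Finset.sum_congr rfl fun i hi => ?_
      simp only [Finset.mem_filter, Finset.mem_univ, true_and] at hi
      simp [yq, hi]
    have hsumcone : ∀ T : Finset (Fin (d + 2)), ∑ i ∈ T, yq d l x i ∈ cone (yq d l x) := by
      intro T
      induction T using Finset.induction_on with
      | empty => simpa using cone_zero' _
      | insert a T ha ih =>
        rw [Finset.sum_insert ha]
        exact cone_add' _ (by simpa using cone_gen' (yq d l x) a 1) ih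
    have hsi : ∀ i : Fin (d + 2), (i : ℕ) < l → sElt d l x - yq d l x i ∈ cone (yq d l x) := by
      intro i hi
      rw [hsy, ← Finset.add_sum_erase _ _ (show i ∈ Finset.univ.filter
        (fun i : Fin (d + 2) => (i : ℕ) < l) by simpa using hi), add_sub_cancel_left]
      exact hsumcone _
    have hcpos : ∀ z ∈ cone (yq d l x), 0 ≤ π' z := by
      rintro z ⟨c, rfl⟩
      rw [map_sum]
      refine Finset.sum_nonneg fun i _ => ?_
      rw [map_zsmul, smul_eq_mul]
      exact mul_nonneg (Int.natCast_nonneg _) (hypos i).le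
    have hs : -sElt d l x ∉ cone (yq d l x) := by
      intro h
      have h1 := hcpos _ h
      have h2 := hcpos _ (hsi ⟨0, by omega⟩ hl1)
      have h3 := hypos ⟨0, by omega⟩
      rw [map_neg] at h1
      rw [map_sub] at h2
      omega
    have hxy : ∀ i j : Fin (d + 2), (i : ℕ) < l → l ≤ (j : ℕ) → ∃ N : ℕ,
        ((MvPolynomial.X i * MvPolynomial.X j : MvPolynomial (Fin (d + 2)) k)) ^ N • u = 0 := by
      intro i j hi hj
      obtain ⟨B, hB⟩ := comb (yq d l x) hAB hgen (sElt d l x) hs J hJ.1 hJ.2 i j (hsi i hi)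
        (QuotientAddGroup.mk g)
      choose! a ha using hB
      have hinj : Set.InjOn (fun b : ℕ => a b • x i + b • x j + g) (Set.Ici B) := by
        have aux : ∀ b b' : ℕ, b' < b →
            a b • x i + b • x j + g ≠ a b' • x i + b' • x j + g := by
          intro b b' hlt heq
          have heq := add_right_cancel heq
          have hpi := (hsplit i).1 hi
          have hpj := (hsplit j).2 hj
          have h1 := congrArg π heq
          simp only [map_add, map_nsmul, nsmul_eq_mul] at h1
          have hlt' : a b' < a b := by
            by_contra hle
            push Not at hle
            have e1 : (a b : ℤ) ≤ a b' := by exact_mod_cast hle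
            have e2 : (b' : ℤ) < b := by exact_mod_cast hlt
            nlinarith
          obtain ⟨e, rfl⟩ := Nat.exists_eq_add_of_lt hlt
          obtain ⟨f, hf⟩ := Nat.exists_eq_add_of_lt hlt'
          rw [hf] at heq
          have h2 : (f + 1) • x i + (e + 1) • x j = 0 := by
            have h3 : (a b' • x i + b' • x j) + ((f + 1) • x i + (e + 1) • x j)
                = a b' • x i + b' • x j := by
              refine Eq.trans ?_ heq; simp only [add_smul]; abel
            simpa using h3
          have h4 := hG3 ((f + 1) • x i) (cone_gen' x i _) (by
            rw [neg_eq_of_add_eq_zero_right h2]; exact cone_gen' x j _)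
          have h5 := congrArg π h4
          rw [map_nsmul, map_zero, nsmul_eq_mul] at h5
          have : 0 < ((f + 1 : ℕ) : ℤ) * π (x i) := by positivity
          omega
        intro b _ b' _ hbb
        by_contra hne
        rcases lt_or_gt_of_ne hne with h | h
        · exact aux b' b h hbb.symm
        · exact aux b b' h hbb
      have hinf := (Set.Ici_infinite B).image hinj
      obtain ⟨_, ⟨b, hb, rfl⟩, hnot⟩ := hinf.exists_notMem_finite hfin
      have hbot : ℳ (a b • x i + b • x j + g) = ⊥ := by
        by_contra hne
        refine hnot ⟨?_, hne⟩
        convert ha b hb using 1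
        have e1 : yq d l x i = QuotientAddGroup.mk (x i) := by simp [yq, hi]
        have e2 : yq d l x j = - QuotientAddGroup.mk (x j) := by
          simp [yq, not_lt.2 hj]
        rw [e1, e2, QuotientAddGroup.mk_add, QuotientAddGroup.mk_add,
          QuotientAddGroup.mk_nsmul, QuotientAddGroup.mk_nsmul, smul_neg]
        abel
      have hz : (MvPolynomial.X i ^ a b * MvPolynomial.X j ^ b :
          MvPolynomial (Fin (d + 2)) k) • u = 0 := by
        have := hcompat (a b • x i + b • x j) g (MvPolynomial.X i ^ a b * MvPolynomial.X j ^ b)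
          u (((MvPolynomial.isWeightedHomogeneous_X k x i).pow _).mul
            ((MvPolynomial.isWeightedHomogeneous_X k x j).pow _)) hu
        rw [hbot] at this
        simpa using this
      refine ⟨a b + b, ?_⟩
      have : (MvPolynomial.X i * MvPolynomial.X j : MvPolynomial (Fin (d + 2)) k) ^ (a b + b)
          = (MvPolynomial.X i ^ b * MvPolynomial.X j ^ a b) *
            (MvPolynomial.X i ^ a b * MvPolynomial.X j ^ b) := by ring
      rw [this, mul_smul, hz, smul_zero]
    have hrad : 𝔞 ≤ Ideal.radical (LinearMap.ker
        (LinearMap.toSpanSingleton (MvPolynomial (Fin (d + 2)) k) M u)) := by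
      rw [h𝔞, Ideal.span_mul_span', Ideal.span_le]
      rintro _ ⟨_, ⟨i, hi, rfl⟩, _, ⟨j, hj, rfl⟩, rfl⟩
      obtain ⟨N, hN⟩ := hxy i j hi hj
      exact ⟨N, by simpa using hN⟩
    obtain ⟨n, hn⟩ := Ideal.exists_pow_le_of_le_radical_of_fg hrad
      (IsNoetherian.noetherian 𝔞)
    exact ⟨n, fun s hs => by simpa using hn hs⟩
  refine ⟨hmain, fun u => ?_⟩
  induction u using DirectSum.Decomposition.inductionOn ℳ with
  | zero => exact ⟨0, fun s _ => smul_zero s⟩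
  | homogeneous m => exact hmain _ _ m.2
  | add m m' h h' =>
    obtain ⟨n, hn⟩ := h
    obtain ⟨n', hn'⟩ := h'
    refine ⟨n + n', fun s hs => ?_⟩
    rw [smul_add, hn s (Ideal.pow_le_pow_right (Nat.le_add_right _ _) hs),
      hn' s (Ideal.pow_le_pow_right (Nat.le_add_left _ _) hs), add_zero]

end Paper
end
end

section
/- The group H := G/ℤp is a finitely generated abelian group of rank one, and the d+2 elements y_1 := q(x_1), …, y_l := q(x_l), y_{l+1} := q(−x_{l+1}), …, y_{d+2} := q(−x_{d+2}) of H satisfy: (G1) y_i ≠ 0 for all i; (G2) H = Σ_{i=1}^{d+2} ℤy_i; (G3) H_{≥0} ∩ (−H_{≥0}) = {0}, where H_{≥0} := Σ_{i=1}^{d+2} ℤ_{≥0}y_i. -/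
open scoped Classical

noncomputable section

namespace Paper

theorem H_rank_one_and_G1G2G3 (d : ℕ) (hd : 1 ≤ d) (G : Type*) [AddCommGroup G]
    (hfg : AddGroup.FG G)
    (ρ : G →+ ℤ × ℤ) (hρsurj : Function.Surjective ρ)
    (hρker : ∀ g : G, ρ g = 0 ↔ IsOfFinAddOrder g)
    (x : Fin (d + 2) → G) (hG1 : ∀ i, x i ≠ 0)
    (hG2 : ∀ g : G, ∃ c : Fin (d + 2) → ℤ, g = ∑ i, c i • x i)
    (hG3 : ∀ g : G, g ∈ cone x → -g ∈ cone x → g = 0)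
    (hp : ¬ IsOfFinAddOrder (∑ i, x i))
    (π : G →+ ℤ) (hπsurj : Function.Surjective π)
    (hπker : ∀ g : G, π g = 0 ↔
      IsOfFinAddOrder (QuotientAddGroup.mk g : G ⧸ AddSubgroup.zmultiples (∑ i, x i)))
    (l : ℕ) (hl1 : 1 ≤ l) (hl2 : l ≤ d + 1)
    (hsplit : ∀ i : Fin (d + 2),
      ((i : ℕ) < l → 0 < π (x i)) ∧ (l ≤ (i : ℕ) → π (x i) < 0)) :
    AddGroup.FG (G ⧸ AddSubgroup.zmultiples (∑ i, x i)) ∧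
    (∃ σ : (G ⧸ AddSubgroup.zmultiples (∑ i, x i)) →+ ℤ, Function.Surjective σ ∧
      ∀ h : G ⧸ AddSubgroup.zmultiples (∑ i, x i), σ h = 0 ↔ IsOfFinAddOrder h) ∧
    (∀ i, yq d l x i ≠ 0) ∧
    (∀ h : G ⧸ AddSubgroup.zmultiples (∑ i, x i),
      ∃ c : Fin (d + 2) → ℤ, h = ∑ i, c i • yq d l x i) ∧
    (∀ h : G ⧸ AddSubgroup.zmultiples (∑ i, x i),
      h ∈ cone (yq d l x) → -h ∈ cone (yq d l x) → h = 0) := by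
  have hpz : π (∑ i, x i) = 0 := by
    rw [hπker]
    have : (QuotientAddGroup.mk (∑ i, x i) : G ⧸ AddSubgroup.zmultiples (∑ i, x i)) = 0 :=
      (QuotientAddGroup.eq_zero_iff _).2 (AddSubgroup.mem_zmultiples _)
    rw [this]
    exact IsOfFinAddOrder.zero
  have hle : AddSubgroup.zmultiples (∑ i, x i) ≤ π.ker := by
    rw [AddSubgroup.zmultiples_le]
    exact hpz
  obtain ⟨σ, hσ⟩ : ∃ σ : (G ⧸ AddSubgroup.zmultiples (∑ i, x i)) →+ ℤ,
      ∀ g : G, σ (QuotientAddGroup.mk g) = π g :=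
    ⟨QuotientAddGroup.lift _ π hle, fun g => rfl⟩
  have hpos : ∀ i, 0 < σ (yq d l x i) := by
    intro i
    unfold yq
    split_ifs with h
    · rw [hσ]; exact (hsplit i).1 h
    · rw [hσ, map_neg]
      have := (hsplit i).2 (not_lt.1 h)
      omega
  refine ⟨?_, ⟨σ, ?_, ?_⟩, ?_, ?_, ?_⟩
  · haveI := hfg
    infer_instance
  · intro n
    obtain ⟨g, hg⟩ := hπsurj n
    exact ⟨QuotientAddGroup.mk g, by rw [hσ, hg]⟩
  · intro h
    obtain ⟨g, rfl⟩ := QuotientAddGroup.mk_surjective h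
    rw [hσ]
    exact hπker g
  · intro i h
    have := hpos i
    rw [h, map_zero] at this
    exact lt_irrefl _ this
  · intro h
    obtain ⟨g, rfl⟩ := QuotientAddGroup.mk_surjective h
    obtain ⟨c, hc⟩ := hG2 g
    refine ⟨fun i => if (i : ℕ) < l then c i else -c i, ?_⟩
    have h1 : (QuotientAddGroup.mk g : G ⧸ AddSubgroup.zmultiples (∑ i, x i)) =
        ∑ i, c i • (QuotientAddGroup.mk (x i) : G ⧸ AddSubgroup.zmultiples (∑ i, x i)) := by
      rw [hc]
      change QuotientAddGroup.mk' _ _ = ∑ i, c i • QuotientAddGroup.mk' _ (x i)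
      rw [map_sum]
      exact Finset.sum_congr rfl fun i _ => map_zsmul _ _ _
    rw [h1]
    refine Finset.sum_congr rfl fun i _ => ?_
    unfold yq
    by_cases hi : (i : ℕ) < l
    · simp only [if_pos hi]
    · simp only [if_neg hi, QuotientAddGroup.mk_neg, neg_smul, smul_neg, neg_neg]
  · rintro h ⟨c, hc⟩ ⟨c', hc'⟩
    have h1 : σ h = ∑ i, (c i : ℤ) * σ (yq d l x i) := by
      rw [hc, map_sum]
      exact Finset.sum_congr rfl fun i _ => by rw [map_zsmul, smul_eq_mul]
    have h2 : -σ h = ∑ i, (c' i : ℤ) * σ (yq d l x i) := by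
      rw [← map_neg, hc', map_sum]
      exact Finset.sum_congr rfl fun i _ => by rw [map_zsmul, smul_eq_mul]
    have n1 : ∀ i ∈ Finset.univ, 0 ≤ (c i : ℤ) * σ (yq d l x i) :=
      fun i _ => mul_nonneg (Int.natCast_nonneg _) (hpos i).le
    have n2 : ∀ i ∈ Finset.univ, 0 ≤ (c' i : ℤ) * σ (yq d l x i) :=
      fun i _ => mul_nonneg (Int.natCast_nonneg _) (hpos i).le
    have s1 := Finset.sum_nonneg n1
    have s2 := Finset.sum_nonneg n2
    have hz : ∑ i, (c i : ℤ) * σ (yq d l x i) = 0 := by omega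
    rw [Finset.sum_eq_zero_iff_of_nonneg n1] at hz
    rw [hc]
    refine Finset.sum_eq_zero fun i hi => ?_
    rcases mul_eq_zero.1 (hz i hi) with h0 | h0
    · rw [h0, zero_smul]
    · exact absurd h0 (hpos i).ne'

end Paper
end
end
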